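/- Let K be an algebraically closed field of characteristic different from 2, let m ≥ 1, and let V be a 2m-dimensional vector space over K equipped with a nondegenerate symmetric bilinear form. Then the set of m-dimensional totally isotropic subspaces of V is nonempty, and the relation on this set defined by U ∼ W if and only if dim(U ∩ W) ≡ m (mod 2) is an equivalence relation with exactly two equivalence classes. -/

import Mathlib

/-!  Over an algebraically closed field of characteristic `≠ 2`, the maximal
(i.e. `m`-dimensional) totally isotropic subspaces of a `2m`-dimensional
nondegenerate symmetric bilinear space form a nonempty set on which
"`dim (U ⊓ W) ≡ m (mod 2)`" is an equivalence relation with exactly two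
classes. -/

open Module

/-- `U` is an `m`-dimensional totally isotropic subspace for `B`. -/
def IsMaxIsotropic {K V : Type*} [Field K] [AddCommGroup V] [Module K V]
    (B : LinearMap.BilinForm K V) (m : ℕ) (U : Submodule K V) : Prop :=
  finrank K ↥U = m ∧ ∀ x ∈ U, ∀ y ∈ U, B x y = 0

/-- `U` and `W` lie in the same family: `dim (U ⊓ W) ≡ m (mod 2)`. -/
def SameFamily {K V : Type*} [Field K] [AddCommGroup V] [Module K V]
    (m : ℕ) (U W : Submodule K V) : Prop :=
  finrank K ↥(U ⊓ W) % 2 = m % 2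

open LinearMap (BilinForm)

section Alternating

variable {K P : Type*} [Field K] [AddCommGroup P] [Module K P] [FiniteDimensional K P]

/-- A nondegenerate alternating form in characteristic `≠ 2` lives on an even-dimensional space. -/
lemma LinearMap.IsAlt.even_finrank_of_separatingLeft (h2 : (2 : K) ≠ 0)
    {ω : BilinForm K P} (hω : ω.IsAlt) (hsep : ω.SeparatingLeft) : Even (finrank K P) := by
  let b := finBasis K P
  have hdet : (BilinForm.toMatrix b ω).det ≠ 0 :=
    (BilinForm.nondegenerate_iff_det_ne_zero b).1
      ((LinearMap.IsRefl.nondegenerate_iff_separatingLeft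
        (LinearMap.IsAlt.isRefl hω)).2 hsep)
  have hskew : (BilinForm.toMatrix b ω).transpose = -BilinForm.toMatrix b ω := by
    ext i j
    simp only [Matrix.transpose_apply, Matrix.neg_apply, BilinForm.toMatrix_apply]
    exact (LinearMap.IsAlt.neg hω _ _).symm
  by_contra hodd
  rw [Nat.not_even_iff_odd] at hodd
  have h := congrArg Matrix.det hskew
  rw [Matrix.det_transpose, Matrix.det_neg, Fintype.card_fin, hodd.neg_one_pow] at h
  apply hdet
  have : (2 : K) * (BilinForm.toMatrix b ω).det = 0 := by linear_combination h
  exact (mul_eq_zero.1 this).resolve_left h2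

/-- The rank of an alternating form in characteristic `≠ 2` is even. -/
lemma LinearMap.IsAlt.exists_finrank_eq_finrank_ker_add (h2 : (2 : K) ≠ 0)
    {ω : BilinForm K P} (hω : ω.IsAlt) :
    ∃ r, finrank K P = finrank K (LinearMap.ker ω) + 2 * r := by
  obtain ⟨C, hC⟩ := Submodule.exists_isCompl (LinearMap.ker ω)
  have hsep : (ω.restrict C).SeparatingLeft := by
    intro x hx
    have hxk : (x : P) ∈ LinearMap.ker ω := by
      rw [LinearMap.mem_ker]
      ext y
      obtain ⟨k, hk, c, hc, rfl⟩ := Submodule.mem_sup.1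
        (hC.sup_eq_top ▸ Submodule.mem_top : y ∈ LinearMap.ker ω ⊔ C)
      have h1 : ω x k = 0 := by
        rw [← LinearMap.IsAlt.neg hω, LinearMap.mem_ker.1 hk]; simp
      have h3 : ω x c = 0 := hx ⟨c, hc⟩
      simp [h1, h3]
    have := hC.disjoint.le_bot ⟨hxk, x.2⟩
    simpa using this
  have halt : (ω.restrict C).IsAlt := fun x => hω x
  obtain ⟨r, hr⟩ := LinearMap.IsAlt.even_finrank_of_separatingLeft h2 halt hsep
  exact ⟨r, by rw [← Submodule.finrank_add_eq_of_isCompl hC, hr]; ring⟩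

end Alternating

section Isotropic

variable {K V : Type*} [Field K] [AddCommGroup V] [Module K V] {B : BilinForm K V} {m : ℕ}

lemma LinearMap.BilinForm.orthogonal_sup (B : BilinForm K V) (U W : Submodule K V) :
    B.orthogonal (U ⊔ W) = B.orthogonal U ⊓ B.orthogonal W := by
  refine le_antisymm
    (le_inf (B.orthogonal_le le_sup_left) (B.orthogonal_le le_sup_right)) ?_
  rintro x ⟨hU, hW⟩ y hy
  obtain ⟨u, hu, w, hw, rfl⟩ := Submodule.mem_sup.1 hy
  have h1 : B u x = 0 := hU u hu
  have h2 : B w x = 0 := hW w hw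
  change B (u + w) x = 0
  simp [h1, h2]

variable [FiniteDimensional K V]

lemma IsMaxIsotropic.orthogonal_eq {U : Submodule K V} (hdim : finrank K V = 2 * m)
    (hnd : B.Nondegenerate) (hU : IsMaxIsotropic B m U) : B.orthogonal U = U := by
  have hle : U ≤ B.orthogonal U := fun x hx y hy => hU.2 y hy x hx
  refine (Submodule.eq_of_le_of_finrank_eq hle ?_).symm
  rw [BilinForm.finrank_orthogonal hnd, hU.1, hdim]
  omega

/-- The parity relation between the pairwise intersections of three maximal isotropic subspaces,
obtained from the alternating form on `W ⊓ (U ⊔ X)` that pairs `w` with the `X`-component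
of `w'`. -/
lemma IsMaxIsotropic.finrank_inf_add_finrank_inf_add_finrank_inf_mod_two
    (h2 : (2 : K) ≠ 0) (hdim : finrank K V = 2 * m) (hsymm : B.IsSymm) (hnd : B.Nondegenerate)
    {U W X : Submodule K V} (hU : IsMaxIsotropic B m U) (hW : IsMaxIsotropic B m W)
    (hX : IsMaxIsotropic B m X) :
    (finrank K ↥(U ⊓ W) + finrank K ↥(W ⊓ X) + finrank K ↥(U ⊓ X)) % 2 = m % 2 := by
  have hrefl : B.IsRefl := hsymm.isRefl
  have hUo := hU.orthogonal_eq hdim hnd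
  have hWo := hW.orthogonal_eq hdim hnd
  have hXo := hX.orthogonal_eq hdim hnd
  have hUX : B.orthogonal (U ⊓ X) = U ⊔ X := by
    rw [← BilinForm.orthogonal_orthogonal hnd hrefl (U ⊔ X), BilinForm.orthogonal_sup, hUo, hXo]
  have hPeq : B.orthogonal (W ⊔ (U ⊓ X)) = W ⊓ (U ⊔ X) := by
    rw [BilinForm.orthogonal_sup, hWo, hUX]
  have hPo : B.orthogonal (W ⊓ (U ⊔ X)) = W ⊔ (U ⊓ X) := by
    rw [← hPeq, BilinForm.orthogonal_orthogonal hnd hrefl]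
  set P : Submodule K V := W ⊓ (U ⊔ X) with hP
  obtain ⟨g, hgX, hgU⟩ : ∃ g : P →ₗ[K] V, (∀ p, g p ∈ X) ∧ ∀ p : P, (p : V) - g p ∈ U := by
    let f : (U × X) →ₗ[K] V := U.subtype.coprod X.subtype
    obtain ⟨s, hs⟩ := f.rangeRestrict.exists_rightInverse_of_surjective f.range_rangeRestrict
    have hle : P ≤ LinearMap.range f := by
      rw [LinearMap.range_coprod, Submodule.range_subtype, Submodule.range_subtype]
      exact inf_le_right
    refine ⟨X.subtype ∘ₗ LinearMap.snd K U X ∘ₗ s ∘ₗ Submodule.inclusion hle,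
      fun p => Subtype.coe_prop _, fun p => ?_⟩
    have h := congrArg Subtype.val (LinearMap.congr_fun hs (Submodule.inclusion hle p))
    have h' : ((s (Submodule.inclusion hle p)).1 : V) + (s (Submodule.inclusion hle p)).2 = p := h
    have h'' : (p : V) - (s (Submodule.inclusion hle p)).2 = (s (Submodule.inclusion hle p)).1 := by
      rw [← h', add_sub_cancel_right]
    change (p : V) - (s (Submodule.inclusion hle p)).2 ∈ U
    rw [h'']
    exact Subtype.coe_prop _
  let ω : BilinForm K P := B.compl₁₂ g P.subtype
  have hωap : ∀ p q : P, ω p q = B (g p) q := fun p q => rfl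
  have halt : ω.IsAlt := by
    intro p
    have h1 := hU.2 _ (hgU p) _ (hgU p)
    have h3 := hX.2 _ (hgX p) _ (hgX p)
    have h4 := hW.2 _ p.2.1 _ p.2.1
    have h5 := hsymm.eq p (g p)
    simp only [map_sub, LinearMap.sub_apply] at h1
    have h6 : 2 * B (g p) p = 0 := by linear_combination h3 + h4 - h1 - h5
    exact (mul_eq_zero.1 h6).resolve_left h2
  have hker : LinearMap.ker ω = (U ⊓ W ⊔ W ⊓ X).comap P.subtype := by
    ext p
    rw [LinearMap.mem_ker, Submodule.mem_comap, Submodule.subtype_apply]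
    constructor
    · intro hp
      have hg : g p ∈ B.orthogonal P := fun q hq => by
        change B q (g p) = 0
        rw [hsymm.eq, ← hωap p ⟨q, hq⟩, hp, LinearMap.zero_apply]
      rw [hPo] at hg
      obtain ⟨w, hw, t, ht, hwt⟩ := Submodule.mem_sup.1 hg
      have hwX : w ∈ X := by
        rw [eq_sub_of_add_eq hwt]
        exact X.sub_mem (hgX p) ht.2
      have hpw : (p : V) - w ∈ U := by
        have : (p : V) - w = (p - g p) + t := by rw [← hwt]; abel
        rw [this]
        exact U.add_mem (hgU p) ht.1
      exact Submodule.mem_sup.2 ⟨p - w, ⟨hpw, W.sub_mem p.2.1 hw⟩, w, ⟨hw, hwX⟩, by abel⟩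
    · intro hp
      obtain ⟨a, ha, b, hb, hab⟩ := Submodule.mem_sup.1 hp
      have hgb : g p - b ∈ U ⊓ X := by
        refine ⟨?_, X.sub_mem (hgX p) hb.2⟩
        have : g p - b = a - (p - g p) := by rw [← hab]; abel
        rw [this]
        exact U.sub_mem ha.1 (hgU p)
      have hg : g p ∈ B.orthogonal P := by
        rw [hPo]
        exact Submodule.mem_sup.2 ⟨b, hb.1, _, hgb, by abel⟩
      ext q
      rw [hωap, hsymm.eq]
      exact hg q q.2
  obtain ⟨r, hr⟩ := LinearMap.IsAlt.exists_finrank_eq_finrank_ker_add h2 halt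
  have hle : U ⊓ W ⊔ W ⊓ X ≤ P :=
    sup_le (le_inf inf_le_right (inf_le_left.trans le_sup_left))
      (le_inf inf_le_left (inf_le_right.trans le_sup_right))
  have hkerdim : finrank K (LinearMap.ker ω) = finrank K ↥(U ⊓ W ⊔ W ⊓ X) := by
    rw [hker]
    exact (Submodule.comapSubtypeEquivOfLe hle).finrank_eq
  have e1 := Submodule.finrank_sup_add_finrank_inf_eq (U ⊓ W) (W ⊓ X)
  have e2 := Submodule.finrank_sup_add_finrank_inf_eq W (U ⊓ X)
  have e3 : finrank K P = finrank K V - finrank K ↥(W ⊔ U ⊓ X) := by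
    rw [← hPeq, BilinForm.finrank_orthogonal hnd]
  have e4 : U ⊓ W ⊓ (W ⊓ X) = W ⊓ (U ⊓ X) := by
    ext; simp only [Submodule.mem_inf]; tauto
  have e5 := Submodule.finrank_le (W ⊔ U ⊓ X)
  have e6 := hW.1
  rw [e4] at e1
  rw [hdim] at e3 e5
  omega

/-- Below half the dimension, an isotropic subspace can be enlarged by one dimension. -/
lemma exists_isMaxIsotropic_succ [IsAlgClosed K] (hsymm : B.IsSymm) (hnd : B.Nondegenerate)
    {k : ℕ} (hk : 2 * k + 2 ≤ finrank K V) {U : Submodule K V} (hU : IsMaxIsotropic B k U) :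
    ∃ U' : Submodule K V, IsMaxIsotropic B (k + 1) U' := by
  have hUo : U ≤ B.orthogonal U := fun x hx y hy => hU.2 y hy x hx
  have ho : finrank K (B.orthogonal U) = finrank K V - k := by
    rw [BilinForm.finrank_orthogonal hnd, hU.1]
  have key : ∀ U₁ : Submodule K V, finrank K U₁ ≤ k + 1 → ∃ v ∈ B.orthogonal U, v ∉ U₁ := by
    intro U₁ h1
    by_contra! h
    have := Submodule.finrank_mono (show B.orthogonal U ≤ U₁ from h)
    omega
  obtain ⟨v, hv, hvU⟩ := key U (by rw [hU.1]; omega)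
  have hsup : ∀ v, v ∉ U → finrank K ↥(U ⊔ K ∙ v) = k + 1 := fun v hv => by
    have h1 := Submodule.finrank_sup_add_finrank_inf_eq U (K ∙ v)
    have hd : Disjoint U (K ∙ v) := Submodule.disjoint_span_singleton_of_notMem hv
    have hv0 : v ≠ 0 := by
      rintro rfl
      exact hv U.zero_mem
    rw [hd.eq_bot, finrank_bot, hU.1, finrank_span_singleton hv0] at h1
    exact h1
  obtain ⟨x, hx, hxU, hxx⟩ : ∃ x ∈ B.orthogonal U, x ∉ U ∧ B x x = 0 := by
    obtain ⟨w, hw, hwU⟩ := key (U ⊔ K ∙ v) (hsup v hvU).le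
    by_cases hvv : B v v = 0
    · exact ⟨v, hv, hvU, hvv⟩
    · obtain ⟨t, ht⟩ := IsAlgClosed.exists_root
        (Polynomial.C (B v v) * Polynomial.X ^ 2 + Polynomial.C (2 * B v w) * Polynomial.X
          + Polynomial.C (B w w))
        (by rw [Polynomial.degree_quadratic hvv]; decide)
      refine ⟨t • v + w, add_mem (Submodule.smul_mem _ _ hv) hw, fun h => hwU ?_, ?_⟩
      · exact Submodule.mem_sup.2 ⟨_, h, -(t • v),
          neg_mem (Submodule.smul_mem _ _ (Submodule.mem_span_singleton_self v)), by abel⟩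
      · simp only [Polynomial.IsRoot.def, Polynomial.eval_add, Polynomial.eval_mul,
          Polynomial.eval_C, Polynomial.eval_pow, Polynomial.eval_X] at ht
        have := hsymm.eq w v
        simp only [map_add, map_smul, LinearMap.add_apply, LinearMap.smul_apply, smul_eq_mul]
        linear_combination ht + t * this
  refine ⟨U ⊔ K ∙ x, hsup x hxU, fun y hy z hz => ?_⟩
  obtain ⟨u, hu, _, hs, rfl⟩ := Submodule.mem_sup.1 hy
  obtain ⟨u', hu', _, hs', rfl⟩ := Submodule.mem_sup.1 hz
  obtain ⟨a, rfl⟩ := Submodule.mem_span_singleton.1 hs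
  obtain ⟨b, rfl⟩ := Submodule.mem_span_singleton.1 hs'
  have h1 : B u x = 0 := hx u hu
  have h3 : B x u' = 0 := by rw [hsymm.eq]; exact hx u' hu'
  simp [h1, h3, hxx, hU.2 u hu u' hu']

lemma exists_isMaxIsotropic [IsAlgClosed K] (hsymm : B.IsSymm) (hnd : B.Nondegenerate)
    {k : ℕ} (hk : 2 * k ≤ finrank K V) : ∃ U : Submodule K V, IsMaxIsotropic B k U := by
  induction k with
  | zero => exact ⟨⊥, finrank_bot K V, by simp⟩
  | succ k ih =>
    obtain ⟨U, hU⟩ := ih (by omega)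
    exact exists_isMaxIsotropic_succ hsymm hnd hk hU

/-- The reflection in an anisotropic vector moves a maximal isotropic subspace to one meeting it
in codimension one. -/
lemma IsMaxIsotropic.exists_finrank_inf_add_one (h2 : (2 : K) ≠ 0) (hm : 1 ≤ m)
    (hdim : finrank K V = 2 * m) (hsymm : B.IsSymm) (hnd : B.Nondegenerate)
    {U : Submodule K V} (hU : IsMaxIsotropic B m U) :
    ∃ W : Submodule K V, IsMaxIsotropic B m W ∧ finrank K ↥(U ⊓ W) + 1 = m := by
  have hUo := hU.orthogonal_eq hdim hnd
  obtain ⟨v, hv⟩ : ∃ v, B v v ≠ 0 := by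
    by_contra! h
    have hB : ∀ x y, B x y = 0 := fun x y => by
      have h1 := h (x + y)
      simp only [map_add, LinearMap.add_apply, h, hsymm.eq y x] at h1
      have : 2 * B x y = 0 := by linear_combination h1
      exact (mul_eq_zero.1 this).resolve_left h2
    have : Nontrivial V := Module.nontrivial_of_finrank_pos (R := K) (by omega)
    obtain ⟨x, hx⟩ := exists_ne (0 : V)
    exact hx (hnd.1 x (hB x))
  obtain ⟨u₀, hu₀, hu₀v⟩ : ∃ u ∈ U, B u v ≠ 0 := by
    by_contra! h
    have hvU : v ∈ U := hUo ▸ (show v ∈ B.orthogonal U from h)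
    exact hv (hU.2 v hvU v hvU)
  let f : Dual K V := (2 / B v v) • B v
  have hfv : f v = 2 := by simp [f, hv]
  have hf : ∀ x, f x = 2 / B v v * B v x := fun x => rfl
  let s := Module.reflection hfv
  have hs : ∀ x, s x = x - f x • v := fun x => Module.reflection_apply x hfv
  have hsB : ∀ x y, B (s x) (s y) = B x y := fun x y => by
    simp only [hs, hf, map_sub, map_smul, LinearMap.sub_apply, LinearMap.smul_apply, smul_eq_mul,
      hsymm.eq x v]
    field_simp
    ring
  refine ⟨U.map (s : V →ₗ[K] V), ⟨?_, ?_⟩, ?_⟩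
  · rw [← hU.1]
    exact LinearEquiv.finrank_map_eq s U
  · rintro _ ⟨x, hx, rfl⟩ _ ⟨y, hy, rfl⟩
    exact (hsB x y).trans (hU.2 x hx y hy)
  · have hinf : U ⊓ U.map (s : V →ₗ[K] V) = (LinearMap.ker ((B v).domRestrict U)).map U.subtype := by
      ext x
      simp only [Submodule.mem_inf, Submodule.mem_map, LinearMap.mem_ker, Submodule.subtype_apply,
        Subtype.exists, LinearMap.domRestrict_apply]
      constructor
      · rintro ⟨hx, y, hy, rfl⟩
        have hsy : s y ∈ U := hx
        rw [hs] at hsy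
        have h1 : f y • v ∈ U := by simpa using U.sub_mem hy hsy
        have h3 : f y = 0 := by
          have h4 := hU.2 _ h1 _ h1
          simp only [map_smul, LinearMap.smul_apply, smul_eq_mul] at h4
          simpa [hv] using h4
        have h5 : B v y = 0 := by
          rw [hf] at h3
          exact (mul_eq_zero.1 h3).resolve_left (div_ne_zero h2 hv)
        refine ⟨y, hy, h5, ?_⟩
        change y = s y
        rw [hs, h3]; simp
      · rintro ⟨y, hy, h, rfl⟩
        refine ⟨hy, y, hy, ?_⟩
        change s y = y
        rw [hs, hf, h]; simp
    rw [hinf, LinearEquiv.finrank_eq (Submodule.equivMapOfInjective _ U.injective_subtype _).symm,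
      ← hU.1]
    apply Module.Dual.finrank_ker_add_one_of_ne_zero
    intro h
    have := LinearMap.congr_fun h ⟨u₀, hu₀⟩
    rw [LinearMap.domRestrict_apply, hsymm.eq] at this
    exact hu₀v this

end Isotropic

theorem maxIsotropic_two_families
    (K V : Type*) [Field K] [IsAlgClosed K] (hchar : ringChar K ≠ 2)
    [AddCommGroup V] [Module K V] [FiniteDimensional K V]
    (m : ℕ) (hm : 1 ≤ m) (hdim : finrank K V = 2 * m)
    (B : LinearMap.BilinForm K V) (hsymm : B.IsSymm) (hnd : B.Nondegenerate) :
    (∃ U : Submodule K V, IsMaxIsotropic B m U) ∧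
    Equivalence (fun U W : {U : Submodule K V // IsMaxIsotropic B m U} =>
      SameFamily m U.1 W.1) ∧
    (∃ U₀ U₁ : {U : Submodule K V // IsMaxIsotropic B m U},
      ¬ SameFamily m U₀.1 U₁.1 ∧
      ∀ U : {U : Submodule K V // IsMaxIsotropic B m U},
        SameFamily m U.1 U₀.1 ∨ SameFamily m U.1 U₁.1) := by
  have h2 : (2 : K) ≠ 0 := Ring.two_ne_zero hchar
  have hpar := fun U W X : {U : Submodule K V // IsMaxIsotropic B m U} =>
    U.2.finrank_inf_add_finrank_inf_add_finrank_inf_mod_two h2 hdim hsymm hnd W.2 X.2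
  obtain ⟨U₀, hU₀⟩ := exists_isMaxIsotropic (k := m) hsymm hnd hdim.ge
  obtain ⟨U₁, hU₁, h01⟩ := hU₀.exists_finrank_inf_add_one h2 hm hdim hsymm hnd
  refine ⟨⟨U₀, hU₀⟩, ⟨fun U => ?_, fun {U W} h => ?_, fun {U W X} h h' => ?_⟩,
    ⟨U₀, hU₀⟩, ⟨U₁, hU₁⟩, ?_, fun U => ?_⟩
  · rw [SameFamily, inf_idem, U.2.1]
  · rwa [SameFamily, inf_comm]
  · have := hpar U W X
    simp only [SameFamily] at *
    omega
  · simp only [SameFamily]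
    omega
  · have := hpar U ⟨U₀, hU₀⟩ ⟨U₁, hU₁⟩
    simp only [SameFamily] at *
    omega
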